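/- arXiv:1708.08069 — 4 statements merged into one kernel-verified Lean document; each statement's English description precedes it below -/
import Mathlib

section
/- For every natural number j ≥ 1, the set of functions f : ℕ → ℕ, supported on k ≥ 1 and nonzero at only finitely many k, satisfying ∑_{k≥1} f(k)·(⌊(8/7)·(15/8)^{k+1}⌋ − 1) = j, is finite and has cardinality at most (15/8)^{0.3·j + 0.73}. -/
/-- The functions `f : ℕ → ℕ` of finite support that vanish at `0` and satisfy
`∑ k, f k * w k = j`: the partitions of `j` into parts `w 1, w 2, …`. -/
def weightedPartitions (w : ℕ → ℕ) (j : ℕ) : Set (ℕ → ℕ) :=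
  {f | f 0 = 0 ∧ (Function.support f).Finite ∧ ∑ᶠ k, f k * w k = j}

section WeightedPartitions

variable {w : ℕ → ℕ} {j : ℕ}

lemma finite_support_mul_right {f : ℕ → ℕ} (hf : (Function.support f).Finite) (w : ℕ → ℕ) :
    (Function.support fun k => f k * w k).Finite :=
  hf.subset fun _ hk => left_ne_zero_of_mul hk

lemma weightedPartitions_zero_subset (hw : ∀ k, 1 ≤ k → 0 < w k) :
    weightedPartitions w 0 ⊆ {0} := by
  rintro f ⟨h0, hf, hs⟩
  funext k
  by_contra hk
  have hk1 : 1 ≤ k := Nat.one_le_iff_ne_zero.2 fun h => hk (h ▸ h0)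
  have := single_le_finsum k (finite_support_mul_right hf w) fun _ => Nat.zero_le _
  rw [hs] at this
  exact absurd this (not_le.2 (Nat.mul_pos (Nat.pos_of_ne_zero hk) (hw k hk1)))

/-- A nonempty partition arises by adding one part to a smaller partition. -/
lemma weightedPartitions_subset_biUnion (hw : ∀ k, k ≤ w k) (hj : j ≠ 0) :
    weightedPartitions w j ⊆ ⋃ k ∈ (Finset.Icc 1 j).filter (w · ≤ j),
      (· + Pi.single k 1) '' weightedPartitions w (j - w k) := by
  rintro f ⟨h0, hf, hs⟩
  obtain ⟨k, hk⟩ : ∃ k, f k ≠ 0 := by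
    by_contra! h
    exact hj (by simpa [h] using hs.symm)
  have hk1 : 1 ≤ k := Nat.one_le_iff_ne_zero.2 fun h => hk (h ▸ h0)
  have hle : w k ≤ j := by
    have := single_le_finsum k (finite_support_mul_right hf w) fun _ => Nat.zero_le _
    rw [hs] at this
    exact (Nat.le_mul_of_pos_left _ (Nat.pos_of_ne_zero hk)).trans this
  have hfg : f - Pi.single k 1 + Pi.single k 1 = f := by
    funext i
    rcases eq_or_ne i k with rfl | hi
    · simp; omega
    · simp [hi]
  have hg : (Function.support (f - Pi.single k 1)).Finite :=
    hf.subset fun i hi h => hi (by simp [h])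
  have hsingle : ∑ᶠ i, (Pi.single k 1 : ℕ → ℕ) i * w i = w k := by
    rw [finsum_eq_single _ k fun i hi => by simp [hi]]
    simp
  have hsum : ∑ᶠ i, (f - Pi.single k 1 : ℕ → ℕ) i * w i + w k = j := by
    rw [← hs, ← hsingle, ← finsum_add_distrib (finite_support_mul_right hg w)
      (finite_support_mul_right ((Set.finite_singleton k).subset Pi.support_single_subset) w)]
    exact finsum_congr fun i => by rw [← add_mul, ← Pi.add_apply, hfg]
  simp only [Set.mem_iUnion, Finset.mem_filter, Finset.mem_Icc]
  exact ⟨k, ⟨⟨hk1, (hw k).trans hle⟩, hle⟩, f - Pi.single k 1,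
    ⟨by simp [h0], hg, by omega⟩, hfg⟩

/-- If the parts satisfy the Kraft-type inequality `∑ x ^ w k ≤ 1`, then there are at most
`x⁻¹ ^ j` partitions of `j`. -/
lemma weightedPartitions_finite_and_ncard_le (hw : ∀ k, k ≤ w k) {x : ℝ} (hx : 0 < x)
    (hsum : ∀ n, ∑ k ∈ Finset.Icc 1 n, x ^ w k ≤ 1) (j : ℕ) :
    (weightedPartitions w j).Finite ∧ ((weightedPartitions w j).ncard : ℝ) ≤ x⁻¹ ^ j := by
  induction j using Nat.strong_induction_on with
  | _ j ih =>
  rcases eq_or_ne j 0 with rfl | hj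
  · have h := weightedPartitions_zero_subset fun k hk => hk.trans (hw k)
    refine ⟨(Set.finite_singleton _).subset h, ?_⟩
    simpa using Set.ncard_le_ncard h
  set s := (Finset.Icc 1 j).filter (w · ≤ j) with hs
  have hlt : ∀ k ∈ s, w k ≤ j ∧ j - w k < j := fun k hk => by
    have := hw k
    simp only [hs, Finset.mem_filter, Finset.mem_Icc] at hk
    omega
  have hsub := weightedPartitions_subset_biUnion hw hj
  have hfin : (⋃ k ∈ s, (· + Pi.single k 1) '' weightedPartitions w (j - w k)).Finite :=
    s.finite_toSet.biUnion fun k hk => (ih _ (hlt k hk).2).1.image _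
  refine ⟨hfin.subset hsub, ?_⟩
  calc ((weightedPartitions w j).ncard : ℝ)
      ≤ ∑ k ∈ s, ((weightedPartitions w (j - w k)).ncard : ℝ) := by
        exact_mod_cast (Set.ncard_le_ncard hsub hfin).trans <|
          (Finset.set_ncard_biUnion_le _ _).trans <|
            Finset.sum_le_sum fun k hk => Set.ncard_image_le (ih _ (hlt k hk).2).1
    _ ≤ ∑ k ∈ s, x⁻¹ ^ j * x ^ w k := by
        refine Finset.sum_le_sum fun k hk => (ih _ (hlt k hk).2).2.trans_eq ?_
        rw [pow_sub₀ _ (inv_ne_zero hx.ne') (hlt k hk).1, inv_pow x (w k), inv_inv]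
    _ = x⁻¹ ^ j * ∑ k ∈ s, x ^ w k := by rw [Finset.mul_sum]
    _ ≤ x⁻¹ ^ j * 1 := by
        gcongr
        exact (Finset.sum_le_sum_of_subset_of_nonneg (Finset.filter_subset _ _)
          fun _ _ _ => by positivity).trans (hsum j)
    _ = x⁻¹ ^ j := mul_one _

end WeightedPartitions

/-- The number of sites by which one commutator at step `k` enlarges the collar. -/
noncomputable def collarWeight (k : ℕ) : ℕ := ⌊(8 / 7 : ℝ) * (15 / 8) ^ (k + 1)⌋₊ - 1

lemma three_le_collarWeight_one : 3 ≤ collarWeight 1 :=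
  Nat.le_sub_of_add_le (Nat.le_floor (by norm_num))

lemma six_le_collarWeight_two : 6 ≤ collarWeight 2 :=
  Nat.le_sub_of_add_le (Nat.le_floor (by norm_num))

lemma le_collarWeight_add_three (n : ℕ) : 13 + 12 * n ≤ collarWeight (n + 3) := by
  refine Nat.le_sub_of_add_le (Nat.le_floor ?_)
  push_cast
  induction n with
  | zero => norm_num
  | succ n ih =>
    have h : (15 / 8 : ℝ) ^ (n + 1 + 3 + 1) = 15 / 8 * (15 / 8) ^ (n + 3 + 1) := by ring
    rw [h]
    push_cast
    have : (0 : ℝ) ≤ n := n.cast_nonneg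
    linarith

lemma le_collarWeight (k : ℕ) : k ≤ collarWeight k := by
  match k with
  | 0 => exact Nat.zero_le _
  | 1 => exact le_trans (by norm_num) three_le_collarWeight_one
  | 2 => exact le_trans (by norm_num) six_le_collarWeight_two
  | n + 3 => exact le_trans (by omega) (le_collarWeight_add_three n)

lemma sum_pow_collarWeight_le_one (n : ℕ) :
    ∑ k ∈ Finset.Icc 1 n, (0.829 : ℝ) ^ collarWeight k ≤ 1 := by
  have htail : ∀ m : ℕ, ∑ k ∈ Finset.range m, (0.829 : ℝ) ^ collarWeight (k + 3) ≤
      0.1 * (1 - (0.829 ^ 12) ^ m) := by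
    intro m
    induction m with
    | zero => simp
    | succ m ih =>
      have h : (0.829 : ℝ) ^ collarWeight (m + 3) ≤ 0.829 ^ 13 * (0.829 ^ 12) ^ m := by
        rw [← pow_mul, ← pow_add]
        exact pow_le_pow_of_le_one (by norm_num) (by norm_num) (le_collarWeight_add_three m)
      have hc : (0.829 : ℝ) ^ 13 ≤ 0.1 * (1 - 0.829 ^ 12) := by norm_num
      have := mul_le_mul_of_nonneg_right hc
        (pow_nonneg (pow_nonneg (by norm_num : (0 : ℝ) ≤ 0.829) 12) m)
      rw [Finset.sum_range_succ, pow_succ]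
      linarith
  have h1 : (0.829 : ℝ) ^ collarWeight 1 ≤ 0.829 ^ 3 :=
    pow_le_pow_of_le_one (by norm_num) (by norm_num) three_le_collarWeight_one
  have h2 : (0.829 : ℝ) ^ collarWeight 2 ≤ 0.829 ^ 6 :=
    pow_le_pow_of_le_one (by norm_num) (by norm_num) six_le_collarWeight_two
  calc ∑ k ∈ Finset.Icc 1 n, (0.829 : ℝ) ^ collarWeight k
      ≤ ∑ k ∈ Finset.Ico 1 (n + 3), (0.829 : ℝ) ^ collarWeight k :=
        Finset.sum_le_sum_of_subset_of_nonneg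
          (fun k hk => by simp only [Finset.mem_Icc, Finset.mem_Ico] at hk ⊢; omega)
          fun _ _ _ => by positivity
    _ = ∑ k ∈ Finset.range n, (0.829 : ℝ) ^ collarWeight (k + 3) +
          0.829 ^ collarWeight 2 + 0.829 ^ collarWeight 1 := by
        rw [Finset.sum_Ico_eq_sum_range, show n + 3 - 1 = n + 1 + 1 by omega,
          Finset.sum_range_succ', Finset.sum_range_succ']
        simp only [add_comm, add_left_comm, Nat.reduceAdd, zero_add]
    _ ≤ 0.1 * (1 - 0) + 0.829 ^ 6 + 0.829 ^ 3 := by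
        gcongr
        exact (htail n).trans (by gcongr; positivity)
    _ ≤ 1 := by norm_num

lemma inv_le_rpow_three_tenths : (0.829 : ℝ)⁻¹ ≤ (15 / 8 : ℝ) ^ (0.3 : ℝ) := by
  refine le_of_pow_le_pow_left₀ (n := 10) (by norm_num) (by positivity) ?_
  rw [← Real.rpow_mul_natCast (by norm_num), show (0.3 : ℝ) * (10 : ℕ) = (3 : ℕ) by norm_num,
    Real.rpow_natCast]
  norm_num


/-- For `j ≥ 1`, the set of finitely supported `f : ℕ → ℕ` vanishing at `0`
with `∑_{k≥1} f(k)·(⌊(8/7)·(15/8)^{k+1}⌋ - 1) = j` is finite and has cardinality at most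
`(15/8)^{0.3·j + 0.73}`. -/
theorem stmt_8 (j : ℕ) (hj : 1 ≤ j) :
    {f : ℕ → ℕ | f 0 = 0 ∧ (Function.support f).Finite ∧
        ∑ᶠ k : ℕ, f k * (⌊(8 / 7 : ℝ) * (15 / 8) ^ (k + 1)⌋₊ - 1) = j}.Finite ∧
    (Nat.card {f : ℕ → ℕ | f 0 = 0 ∧ (Function.support f).Finite ∧
        ∑ᶠ k : ℕ, f k * (⌊(8 / 7 : ℝ) * (15 / 8) ^ (k + 1)⌋₊ - 1) = j} : ℝ)
      ≤ (15 / 8 : ℝ) ^ ((0.3 : ℝ) * (j : ℝ) + 0.73) := by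
  obtain ⟨hfin, hcard⟩ := weightedPartitions_finite_and_ncard_le le_collarWeight
    (by norm_num : (0 : ℝ) < 0.829) sum_pow_collarWeight_le_one j
  refine ⟨hfin, hcard.trans ?_⟩
  calc (0.829 : ℝ)⁻¹ ^ j ≤ ((15 / 8 : ℝ) ^ (0.3 : ℝ)) ^ j :=
        pow_le_pow_left₀ (by norm_num) inv_le_rpow_three_tenths j
    _ = (15 / 8 : ℝ) ^ ((0.3 : ℝ) * (j : ℝ)) := (Real.rpow_mul_natCast (by norm_num) _ _).symm
    _ ≤ (15 / 8 : ℝ) ^ ((0.3 : ℝ) * (j : ℝ) + 0.73) :=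
        Real.rpow_le_rpow_of_exponent_le (by norm_num) (by norm_num)
end

section
/- For every real number j ≥ 1, ln((15/7)·j) · ln((7/15)·(j+2)) / (2·ln(15/8)) ≤ (0.3·j + 0.73) / ln(15/8). -/
theorem sq_le_exp_of_nonneg {t : ℝ} (ht : 0 ≤ t) : t ^ 2 ≤ 0.6 * Real.exp t + 0.86 := by
  have h := Real.sum_le_exp_of_nonneg ht 5
  norm_num [Finset.sum_range_succ, Nat.factorial] at h
  nlinarith [sq_nonneg (t ^ 2 + 2 * t - 9), sq_nonneg (t - 2), mul_nonneg ht (sq_nonneg (t - 2))]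

/-- For every real `j ≥ 1`,
`ln((15/7)j) · ln((7/15)(j+2)) / (2 ln(15/8)) ≤ (0.3j + 0.73)/ln(15/8)`. -/
theorem stmt_10 (j : ℝ) (hj : 1 ≤ j) :
    Real.log ((15 / 7) * j) * Real.log ((7 / 15) * (j + 2)) / (2 * Real.log (15 / 8))
      ≤ (0.3 * j + 0.73) / Real.log (15 / 8) := by
  have hlog : 0 < Real.log (15 / 8) := Real.log_pos (by norm_num)
  have hsum : Real.log ((15 / 7) * j) + Real.log ((7 / 15) * (j + 2)) = Real.log (j * (j + 2)) := by
    rw [← Real.log_mul (by positivity) (by positivity)]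
    congr 1
    ring
  have hnonneg : 0 ≤ Real.log (j * (j + 2)) := Real.log_nonneg (by nlinarith)
  have hle : Real.log (j * (j + 2)) ≤ 2 * Real.log (j + 1) := by
    have h := Real.log_le_log (by positivity : 0 < j * (j + 2))
      (by nlinarith : j * (j + 2) ≤ (j + 1) ^ 2)
    rwa [Real.log_pow, Nat.cast_ofNat] at h
  have hsq := sq_le_exp_of_nonneg (Real.log_nonneg (by linarith : 1 ≤ j + 1))
  rw [Real.exp_log (by linarith)] at hsq
  have hprod : Real.log ((15 / 7) * j) * Real.log ((7 / 15) * (j + 2))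
      ≤ 2 * (0.3 * j + 0.73) := by
    have hpow := pow_le_pow_left₀ hnonneg hle 2
    rw [← hsum] at hpow
    linarith [four_mul_le_sq_add (Real.log ((15 / 7) * j)) (Real.log ((7 / 15) * (j + 2)))]
  rw [div_le_div_iff₀ (by positivity) hlog]
  nlinarith
end

section
/- Fix an integer i and a natural number x ≥ 1. The set of functions g : Fin x → ℤ such that g(0) = i and for every index n with n ≥ 1 there exists an index m < n with |g(n) − g(m)| ≤ 1, is finite and has cardinality at most (2x − 1)!!, the double factorial of 2x − 1. -/
/-- Every entry of `g` but the first is within distance one of an earlier entry. -/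
def IsNearPath {k : ℕ} (g : Fin k → ℤ) : Prop :=
  ∀ n : Fin k, 1 ≤ (n : ℕ) → ∃ m : Fin k, m < n ∧ |g n - g m| ≤ 1

/-- The integers within distance one of an entry of `g`. -/
noncomputable def nearSites {k : ℕ} (g : Fin k → ℤ) : Finset ℤ :=
  Finset.univ.biUnion fun m => Finset.Icc (g m - 1) (g m + 1)

theorem mem_nearSites {k : ℕ} {g : Fin k → ℤ} {a : ℤ} :
    a ∈ nearSites g ↔ ∃ m, |a - g m| ≤ 1 := by
  simp only [nearSites, Finset.mem_biUnion, Finset.mem_univ, true_and, Finset.mem_Icc, abs_le]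
  refine exists_congr fun m => ?_
  constructor <;> rintro ⟨h₁, h₂⟩ <;> constructor <;> linarith

theorem IsNearPath.init {k : ℕ} {g : Fin (k + 1) → ℤ} (hg : IsNearPath g) :
    IsNearPath (Fin.init g) := by
  intro n hn
  obtain ⟨m, hm, hgm⟩ := hg n.castSucc (by simpa using hn)
  have hmn : (m : ℕ) < n := by simpa [Fin.lt_def] using hm
  exact ⟨⟨m, hmn.trans n.2⟩, Fin.lt_def.2 hmn, hgm⟩

theorem IsNearPath.last_mem_nearSites {k : ℕ} {g : Fin (k + 2) → ℤ} (hg : IsNearPath g) :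
    g (Fin.last (k + 1)) ∈ nearSites (Fin.init g) := by
  obtain ⟨m, hm, hgm⟩ := hg (Fin.last (k + 1)) (by simp)
  exact mem_nearSites.2 ⟨⟨m, Fin.lt_def.1 hm⟩, hgm⟩

theorem IsNearPath.card_nearSites_le {k : ℕ} {g : Fin (k + 1) → ℤ} (hg : IsNearPath g) :
    (nearSites g).card ≤ 2 * k + 3 := by
  induction k with
  | zero => simp [nearSites]; omega
  | succ k ih =>
    set a := g (Fin.last (k + 1)) with ha
    have hsub : nearSites g ⊆ nearSites (Fin.init g) ∪ {a - 1, a + 1} := by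
      intro b hb
      obtain ⟨m, hm⟩ := mem_nearSites.1 hb
      simp only [Finset.mem_union, Finset.mem_insert, Finset.mem_singleton]
      induction m using Fin.lastCases with
      | cast m => exact Or.inl (mem_nearSites.2 ⟨m, hm⟩)
      | last =>
        rw [← ha, abs_le] at hm
        by_cases hba : b = a
        · exact Or.inl (hba ▸ hg.last_mem_nearSites)
        · right; omega
    have hcard := (Finset.card_le_card hsub).trans (Finset.card_union_le _ _)
    have hpair := Finset.card_le_two (a := a - 1) (b := a + 1)
    have hinit := ih hg.init
    omega

theorem exists_finset_isNearPath (i : ℤ) (k : ℕ) :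
    ∃ F : Finset (Fin (k + 1) → ℤ), (∀ g, g ∈ F ↔ g 0 = i ∧ IsNearPath g) ∧
      F.card ≤ Nat.doubleFactorial (2 * k + 1) := by
  classical
  induction k with
  | zero =>
    refine ⟨{fun _ => i}, fun g => ?_, by simp⟩
    rw [Finset.mem_singleton]
    refine ⟨?_, fun h => funext fun n => ?_⟩
    · rintro rfl
      exact ⟨rfl, fun n hn => by omega⟩
    · rw [Fin.fin_one_eq_zero n, ← h.1]
  | succ k ih =>
    obtain ⟨F, hF, hcard⟩ := ih
    let E : Finset (Fin (k + 2) → ℤ) :=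
      F.biUnion fun f => (nearSites f).image fun a => Fin.snoc (α := fun _ => ℤ) f a
    have hE : {g : Fin (k + 2) → ℤ | g 0 = i ∧ IsNearPath g} ⊆ E := by
      rintro g ⟨h0, hg⟩
      refine Finset.mem_coe.2 (Finset.mem_biUnion.2 ⟨Fin.init g, (hF _).2 ⟨h0, hg.init⟩, ?_⟩)
      exact Finset.mem_image.2 ⟨_, hg.last_mem_nearSites, Fin.snoc_init_self g⟩
    refine ⟨E.filter fun g => g 0 = i ∧ IsNearPath g, fun g => ?_, ?_⟩
    · rw [Finset.mem_filter]
      exact ⟨fun h => h.2, fun h => ⟨hE h, h⟩⟩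
    · calc _ ≤ E.card := Finset.card_filter_le _ _
        _ ≤ F.card * (2 * k + 3) := Finset.card_biUnion_le_card_mul _ _ _ fun f hf =>
            Finset.card_image_le.trans ((hF f).1 hf).2.card_nearSites_le
        _ ≤ Nat.doubleFactorial (2 * k + 1) * (2 * k + 3) := Nat.mul_le_mul_right _ hcard
        _ = Nat.doubleFactorial (2 * (k + 1) + 1) := by
            rw [show 2 * (k + 1) + 1 = (2 * k + 1) + 2 by ring, Nat.doubleFactorial_add_two,
              mul_comm]

/-- For a fixed site `i : ℤ` and `x ≥ 1`, the set of paths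
`g : Fin x → ℤ` with `g(0) = i` such that every later flip lands within one lattice spacing
of a previous one is finite, of cardinality at most the double factorial `(2x - 1)‼`. -/
theorem stmt_16 (i : ℤ) (x : ℕ) (hx : 1 ≤ x) :
    {g : Fin x → ℤ | g ⟨0, hx⟩ = i ∧
        ∀ n : Fin x, 1 ≤ (n : ℕ) → ∃ m : Fin x, m < n ∧ |g n - g m| ≤ 1}.Finite ∧
    Nat.card {g : Fin x → ℤ | g ⟨0, hx⟩ = i ∧
        ∀ n : Fin x, 1 ≤ (n : ℕ) → ∃ m : Fin x, m < n ∧ |g n - g m| ≤ 1}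
      ≤ Nat.doubleFactorial (2 * x - 1) := by
  obtain ⟨k, rfl⟩ := Nat.exists_eq_add_of_le' hx
  obtain ⟨F, hF, hcard⟩ := exists_finset_isNearPath i k
  have hset : {g : Fin (k + 1) → ℤ | g ⟨0, hx⟩ = i ∧
      ∀ n : Fin (k + 1), 1 ≤ (n : ℕ) → ∃ m : Fin (k + 1), m < n ∧ |g n - g m| ≤ 1} = ↑F :=
    Set.ext fun g => (hF g).symm
  rw [hset, Nat.card_coe_set_eq, Set.ncard_coe_finset]
  exact ⟨F.finite_toSet, hcard⟩
end

section
/- With L_k = (15/8)^k, for every real χ with 0 < χ ≤ 2^{−8}, the series ∑_{k=1}^{∞} 2^{⌊(8/7)·L_{k+1}⌋} · χ^{⌈L_{k−1}⌉} converges and its sum is at most 2^8·χ. -/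
/-- The exponents `⌊(8/7)·L_{k+2}⌋` and `8·⌈L_k⌉` differ by at least `k + 1`. -/
lemma floor_add_succ_le_eight_mul_ceil (k : ℕ) :
    ⌊(8 / 7 : ℝ) * (15 / 8) ^ (k + 1 + 1)⌋₊ + (k + 1) ≤ 8 * ⌈(15 / 8 : ℝ) ^ k⌉₊ := by
  have hfloor : (⌊(8 / 7 : ℝ) * (15 / 8) ^ (k + 1 + 1)⌋₊ : ℝ) ≤
      (8 / 7 : ℝ) * (15 / 8) ^ (k + 1 + 1) := Nat.floor_le (by positivity)
  have hceil := Nat.le_ceil ((15 / 8 : ℝ) ^ k)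
  have hbern : 1 + (k : ℝ) * (7 / 8) ≤ (1 + 7 / 8 : ℝ) ^ k :=
    one_add_mul_le_pow (by norm_num) k
  norm_num at hbern
  rw [pow_succ, pow_succ] at hfloor
  rw [← Nat.cast_le (α := ℝ), pow_succ, pow_succ]
  push_cast
  linarith [Nat.cast_nonneg (α := ℝ) k]

lemma two_pow_floor_mul_pow_ceil_le {χ : ℝ} (hχ0 : 0 < χ) (hχ : χ ≤ ((2 : ℝ) ^ 8)⁻¹) (k : ℕ) :
    (2 : ℝ) ^ ⌊(8 / 7 : ℝ) * (15 / 8) ^ (k + 1 + 1)⌋₊ * χ ^ ⌈(15 / 8 : ℝ) ^ k⌉₊ ≤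
      2 ^ 7 * χ * (1 / 2) ^ k := by
  have hexp := floor_add_succ_le_eight_mul_ceil k
  obtain ⟨c, hc⟩ : ∃ c, ⌈(15 / 8 : ℝ) ^ k⌉₊ = c + 1 :=
    Nat.exists_eq_succ_of_ne_zero (Nat.ceil_pos.2 (by positivity)).ne'
  generalize ⌊(8 / 7 : ℝ) * (15 / 8) ^ (k + 1 + 1)⌋₊ = f at hexp ⊢
  rw [hc] at hexp ⊢
  have hpow : (2 : ℝ) ^ (f + k) ≤ 2 ^ (7 + 8 * c) :=
    pow_le_pow_right₀ (by norm_num) (by omega)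
  rw [pow_add, pow_add, pow_mul] at hpow
  have hχc : χ ^ c ≤ (((2 : ℝ) ^ 8) ^ c)⁻¹ := by
    rw [← inv_pow]
    exact pow_le_pow_left₀ hχ0.le hχ c
  calc (2 : ℝ) ^ f * χ ^ (c + 1) = 2 ^ f * χ ^ c * χ := by ring
    _ ≤ 2 ^ f * (((2 : ℝ) ^ 8) ^ c)⁻¹ * χ := by gcongr
    _ ≤ 2 ^ 7 * (1 / 2) ^ k * χ := by
      refine mul_le_mul_of_nonneg_right ?_ hχ0.le
      rw [one_div, inv_pow, ← div_eq_mul_inv, ← div_eq_mul_inv,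
        div_le_div_iff₀ (by positivity) (by positivity)]
      exact hpow
    _ = 2 ^ 7 * χ * (1 / 2) ^ k := by ring

/-- With `L_k = (15/8)^k` and `0 < χ ≤ 2^{-8}`, the series
`∑_{k=1}^∞ 2^{⌊(8/7)·L_{k+1}⌋} · χ^{⌈L_{k-1}⌉}` converges and its sum is at most `2^8·χ`.
(The sum over `k ≥ 1` is written with the index shifted by one.) -/
theorem stmt_18 (χ : ℝ) (hχ0 : 0 < χ) (hχ : χ ≤ ((2 : ℝ) ^ 8)⁻¹) :
    (Summable fun k : ℕ =>
      (2 : ℝ) ^ ⌊(8 / 7 : ℝ) * (15 / 8) ^ (k + 1 + 1)⌋₊ * χ ^ ⌈(15 / 8 : ℝ) ^ k⌉₊) ∧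
    ∑' k : ℕ, (2 : ℝ) ^ ⌊(8 / 7 : ℝ) * (15 / 8) ^ (k + 1 + 1)⌋₊ * χ ^ ⌈(15 / 8 : ℝ) ^ k⌉₊
      ≤ 2 ^ 8 * χ := by
  have hgeom : HasSum (fun k : ℕ => 2 ^ 7 * χ * (1 / 2 : ℝ) ^ k) (2 ^ 7 * χ * 2) :=
    hasSum_geometric_two.mul_left _
  have hle := two_pow_floor_mul_pow_ceil_le hχ0 hχ
  have hsum := Summable.of_nonneg_of_le (fun k => by positivity) hle hgeom.summable
  refine ⟨hsum, (hasSum_le hle hsum.hasSum hgeom).trans_eq ?_⟩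
  ring
end
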